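/- Suppose (n−1)² ≥ (v̄ − c)/(m − c). Then every reserve price r ∈ [0,c] is a maxmin reserve price: for every r ∈ [0,c], inf_{F ∈ Δ₁(m,v̄)} R(F,r) = inf_{F ∈ Δ₁(m,v̄)} R(F,c) = sup_{r' ≥ 0} inf_{F ∈ Δ₁(m,v̄)} R(F,r'). -/

import Mathlib

open MeasureTheory Set Filter

/-- Expected revenue of a second-price auction with `n` bidders, seller's valuation `c`,
value cdf `F` and reserve price `r`. -/
noncomputable def revenue (n : ℕ) (c : ℝ) (F : ℝ → ℝ) (r : ℝ) : ℝ :=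
  r - (r - c) * F r ^ n +
    ∫ v in Set.Ioi r, (1 - (n : ℝ) * F v ^ (n - 1) + ((n : ℝ) - 1) * F v ^ n)

/-- The set of cdfs with support in `[0, vbar]` and mean `m`. -/
def Delta1 (m vbar : ℝ) (F : ℝ → ℝ) : Prop :=
  Monotone F ∧ (∀ x, ContinuousWithinAt F (Set.Ici x) x) ∧
    (∀ v < 0, F v = 0) ∧ (∀ v ≥ vbar, F v = 1) ∧
    (∫ v in (0:ℝ)..vbar, (1 - F v)) = m

/-- Bernoulli's inequality in homogeneous form. -/
lemma pow_mul_add_le_pow_mul (N : ℕ) {x y : ℝ} (hx : 0 ≤ x) (hy : 0 < y) :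
    y ^ N * (y + N * (x - y)) ≤ x ^ N * y := by
  have hB := one_add_mul_le_pow (a := x / y - 1) (by have := div_nonneg hx hy.le; linarith) N
  have h1 : y ^ N * (y + N * (x - y)) = y ^ N * y * (1 + N * (x / y - 1)) := by field_simp
  have h2 : x ^ N * y = y ^ N * y * (1 + (x / y - 1)) ^ N := by
    rw [add_sub_cancel, div_pow]; field_simp
  rw [h1, h2]
  gcongr

/-- The nonnegative point at which the line through `(0, 1)` is tangent to
`y ↦ 1 - (N + 2) y ^ (N + 1) + (N + 1) y ^ (N + 2)`. -/
noncomputable def tangencyPoint (N : ℕ) : ℝ := N * (N + 2) / (N + 1) ^ 2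

/-- The absolute slope of the tangent line at `tangencyPoint N`. -/
noncomputable def tangentSlope (N : ℕ) : ℝ := (N + 2) / (N + 1) * tangencyPoint N ^ N

lemma tangencyPoint_nonneg (N : ℕ) : 0 ≤ tangencyPoint N := by
  unfold tangencyPoint; positivity

lemma tangencyPoint_eq (N : ℕ) : tangencyPoint N = 1 - 1 / ((N : ℝ) + 1) ^ 2 := by
  unfold tangencyPoint; field_simp; ring

lemma tangencyPoint_le_one (N : ℕ) : tangencyPoint N ≤ 1 := by
  rw [tangencyPoint_eq]
  have : 0 ≤ 1 / ((N : ℝ) + 1) ^ 2 := by positivity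
  linarith

lemma tangentSlope_nonneg (N : ℕ) : 0 ≤ tangentSlope N :=
  mul_nonneg (by positivity) (pow_nonneg (tangencyPoint_nonneg N) _)

/-- The tail probability of the second highest of `N + 2` iid values, as a function of the value
`y` of their common cdf. -/
noncomputable def secondOrderTail (N : ℕ) (y : ℝ) : ℝ :=
  1 - ((N : ℝ) + 2) * y ^ (N + 1) + ((N : ℝ) + 1) * y ^ (N + 2)

lemma secondOrderTail_nonneg (N : ℕ) {y : ℝ} (hy : 0 ≤ y) : 0 ≤ secondOrderTail N y := by
  unfold secondOrderTail
  rcases hy.eq_or_lt with rfl | hy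
  · simp
  · have h := pow_mul_add_le_pow_mul (N + 2) zero_le_one hy
    push_cast at h
    rw [one_pow, one_mul] at h
    refine nonneg_of_mul_nonneg_left ?_ hy
    ring_nf at h ⊢
    linarith

lemma one_sub_tangentSlope_mul_le (N : ℕ) {y : ℝ} (hy : 0 ≤ y) :
    1 - tangentSlope N * y ≤ secondOrderTail N y := by
  unfold secondOrderTail
  rcases hy.eq_or_lt with rfl | hy
  · simp
  · have h := pow_mul_add_le_pow_mul N (tangencyPoint_nonneg N) hy
    have h1 : ((N : ℝ) + 2) * y - (N + 1) * y ^ 2 ≤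
        (N + 2) / (N + 1) * (y + N * (tangencyPoint N - y)) := by
      have : (N + 2) / (N + 1) * (y + N * (tangencyPoint N - y)) -
          (((N : ℝ) + 2) * y - (N + 1) * y ^ 2) = (N + 1) * (y - tangencyPoint N) ^ 2 := by
        unfold tangencyPoint; field_simp; ring
      have : 0 ≤ ((N : ℝ) + 1) * (y - tangencyPoint N) ^ 2 := by positivity
      linarith
    have h2 := mul_le_mul_of_nonneg_left h1 (pow_nonneg hy.le N)
    have h3 := mul_le_mul_of_nonneg_left h (show (0 : ℝ) ≤ (N + 2) / (N + 1) by positivity)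
    have h4 : y ^ N * (((N : ℝ) + 2) * y - (N + 1) * y ^ 2) =
      ((N : ℝ) + 2) * y ^ (N + 1) - ((N : ℝ) + 1) * y ^ (N + 2) := by ring
    have h5 : tangentSlope N * y = (N + 2) / (N + 1) * (tangencyPoint N ^ N * y) := by
      unfold tangentSlope; ring
    have h6 := mul_left_comm (y ^ N) (((N : ℝ) + 2) / (N + 1))
      (y + N * (tangencyPoint N - y))
    linarith

lemma secondOrderTail_tangencyPoint (N : ℕ) :
    secondOrderTail N (tangencyPoint N) = 1 - tangentSlope N * tangencyPoint N := by
  have h : ((N : ℝ) + 2) - (N + 1) * tangencyPoint N = (N + 2) / (N + 1) := by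
    unfold tangencyPoint; field_simp; ring
  unfold secondOrderTail tangentSlope
  rw [← h]; ring

lemma tangentSlope_mul_tangencyPoint_le {N : ℕ} (hN : 1 ≤ N) {y : ℝ}
    (hxy : tangencyPoint N ≤ y) (hy : y ≤ 1) :
    tangentSlope N * tangencyPoint N ≤
      y ^ N * (y ^ 2 + (N + 2) * tangencyPoint N * (1 - y)) := by
  have hN' : (1 : ℝ) ≤ N := by exact_mod_cast hN
  have hx : 0 < tangencyPoint N := by unfold tangencyPoint; positivity
  have h := pow_mul_add_le_pow_mul N (hx.le.trans hxy) hx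
  have hB : 0 ≤ y ^ 2 + (N + 2) * tangencyPoint N * (1 - y) := by
    have := sub_nonneg.2 hy
    positivity
  have h1 := mul_le_mul_of_nonneg_right h hB
  have key : (N + 2) / (N + 1) * tangencyPoint N ^ 2 ≤
      (tangencyPoint N + N * (y - tangencyPoint N)) *
        (y ^ 2 + (N + 2) * tangencyPoint N * (1 - y)) := by
    have hw : 0 ≤ y - tangencyPoint N := sub_nonneg.2 hxy
    have hid : (tangencyPoint N + N * (y - tangencyPoint N)) *
        (y ^ 2 + (N + 2) * tangencyPoint N * (1 - y)) -
        (N + 2) / (N + 1) * tangencyPoint N ^ 2 =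
        (y - tangencyPoint N) * (tangencyPoint N *
          (tangencyPoint N + (1 - (N : ℝ) ^ 2) * (y - tangencyPoint N)) +
          N * (y - tangencyPoint N) ^ 2) := by
      unfold tangencyPoint; field_simp; ring
    have h2 : 0 ≤ tangencyPoint N + (1 - (N : ℝ) ^ 2) * (y - tangencyPoint N) := by
      have h3 : y - tangencyPoint N ≤ 1 / ((N : ℝ) + 1) ^ 2 := by
        rw [tangencyPoint_eq]; linarith
      have h4 : ((N : ℝ) ^ 2 - 1) * (y - tangencyPoint N) ≤
          ((N : ℝ) ^ 2 - 1) * (1 / ((N : ℝ) + 1) ^ 2) :=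
        mul_le_mul_of_nonneg_left h3 (by nlinarith)
      have h5 : tangencyPoint N - ((N : ℝ) ^ 2 - 1) * (1 / ((N : ℝ) + 1) ^ 2) =
          (2 * N + 1) / ((N : ℝ) + 1) ^ 2 := by
        unfold tangencyPoint; field_simp; ring
      have h6 : 0 ≤ (2 * N + 1) / ((N : ℝ) + 1) ^ 2 := by positivity
      linarith
    have : 0 ≤ (y - tangencyPoint N) * (tangencyPoint N *
          (tangencyPoint N + (1 - (N : ℝ) ^ 2) * (y - tangencyPoint N)) +
          N * (y - tangencyPoint N) ^ 2) := by positivity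
    linarith
  have h7 := mul_le_mul_of_nonneg_left key (pow_nonneg hx.le N)
  refine le_of_mul_le_mul_right ?_ hx
  unfold tangentSlope
  linarith

section Delta1

variable {m vbar : ℝ} {F : ℝ → ℝ}

lemma Delta1.nonneg (hF : Delta1 m vbar F) (v : ℝ) : 0 ≤ F v := by
  rw [← hF.2.2.1 (min v (-1)) (by simp)]
  exact hF.1 (min_le_left _ _)

lemma Delta1.le_one (hF : Delta1 m vbar F) (v : ℝ) : F v ≤ 1 := by
  rw [← hF.2.2.2.1 (max v vbar) (le_max_right _ _)]
  exact hF.1 (le_max_left _ _)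

lemma Delta1.intervalIntegrable_pow (hF : Delta1 m vbar F) (k : ℕ) (a b : ℝ) :
    IntervalIntegrable (fun v => F v ^ k) volume a b :=
  Monotone.intervalIntegrable fun _ _ h => pow_le_pow_left₀ (hF.nonneg _) (hF.1 h) k

lemma Delta1.intervalIntegrable (hF : Delta1 m vbar F) (a b : ℝ) :
    IntervalIntegrable F volume a b :=
  hF.1.intervalIntegrable

lemma Delta1.intervalIntegral_le (hF : Delta1 m vbar F) {r : ℝ} (hr : 0 ≤ r) :
    ∫ v in r..vbar, F v ≤ vbar - m := by
  have h1 := hF.2.2.2.2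
  rw [intervalIntegral.integral_sub (by simp) (hF.intervalIntegrable _ _)] at h1
  have h2 := intervalIntegral.integral_add_adjacent_intervals
    (hF.intervalIntegrable 0 r) (hF.intervalIntegrable r vbar)
  have h3 : 0 ≤ ∫ v in (0 : ℝ)..r, F v :=
    intervalIntegral.integral_nonneg hr fun v _ => hF.nonneg v
  simp at h1
  linarith

lemma revenue_eq (N : ℕ) (c : ℝ) (F : ℝ → ℝ) (r : ℝ) :
    revenue (N + 2) c F r =
      r - (r - c) * F r ^ (N + 2) + ∫ v in Ioi r, secondOrderTail N (F v) := by
  unfold revenue secondOrderTail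
  have h : ((N + 2 : ℕ) : ℝ) - 1 = N + 1 := by push_cast; ring
  rw [h]
  push_cast
  rfl

lemma secondOrderTail_one (N : ℕ) : secondOrderTail N 1 = 0 := by
  unfold secondOrderTail; ring

lemma secondOrderTail_zero (N : ℕ) : secondOrderTail N 0 = 1 := by
  simp [secondOrderTail]

lemma revenue_eq_intervalIntegral (N : ℕ) (c : ℝ) {r : ℝ} (hF : ∀ v ≥ vbar, F v = 1)
    (hr : r ≤ vbar) :
    revenue (N + 2) c F r =
      r - (r - c) * F r ^ (N + 2) + ∫ v in r..vbar, secondOrderTail N (F v) := by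
  rw [revenue_eq, intervalIntegral.integral_of_le hr]
  congr 1
  refine setIntegral_eq_of_subset_of_forall_sdiff_eq_zero measurableSet_Ioi
    Ioc_subset_Ioi_self fun v hv => ?_
  have : vbar < v := by
    by_contra! h
    exact hv.2 ⟨hv.1, h⟩
  rw [hF v this.le, secondOrderTail_one]

lemma Delta1.le_revenue_of_le (hF : Delta1 m vbar F) (N : ℕ) {c r : ℝ} (hr : c ≤ r) :
    c ≤ revenue (N + 2) c F r := by
  rw [revenue_eq]
  have h1 : 0 ≤ ∫ v in Ioi r, secondOrderTail N (F v) :=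
    setIntegral_nonneg measurableSet_Ioi fun v _ => secondOrderTail_nonneg N (hF.nonneg v)
  have h2 : F r ^ (N + 2) ≤ 1 := pow_le_one₀ (hF.nonneg r) (hF.le_one r)
  have h3 := mul_le_mul_of_nonneg_left h2 (sub_nonneg.2 hr)
  linarith

lemma Delta1.sub_tangentSlope_mul_le_revenue (hF : Delta1 m vbar F) (N : ℕ) {c r : ℝ}
    (hr : 0 ≤ r) (hrc : r ≤ c) (hcv : c ≤ vbar) :
    vbar - tangentSlope N * (vbar - m) ≤ revenue (N + 2) c F r := by
  rw [revenue_eq_intervalIntegral N c hF.2.2.2.1 (hrc.trans hcv)]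
  have hk : IntervalIntegrable (fun v => tangentSlope N * F v) volume r vbar :=
    (hF.intervalIntegrable _ _).const_mul _
  have h1 : ∫ v in r..vbar, (1 - tangentSlope N * F v) ≤
      ∫ v in r..vbar, secondOrderTail N (F v) := by
    refine intervalIntegral.integral_mono_on (hrc.trans hcv)
      (intervalIntegrable_const.sub hk) ?_
      fun v _ => one_sub_tangentSlope_mul_le N (hF.nonneg v)
    exact ((intervalIntegrable_const).sub
      ((hF.intervalIntegrable_pow (N + 1) _ _).const_mul _)).add
      ((hF.intervalIntegrable_pow (N + 2) _ _).const_mul _)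
  rw [intervalIntegral.integral_sub (by simp) hk, intervalIntegral.integral_const_mul] at h1
  simp at h1
  have h2 := mul_le_mul_of_nonneg_left (hF.intervalIntegral_le hr) (tangentSlope_nonneg N)
  have h3 : 0 ≤ (c - r) * F r ^ (N + 2) :=
    mul_nonneg (sub_nonneg.2 hrc) (pow_nonneg (hF.nonneg r) _)
  linarith

end Delta1

/-- The cdf with an atom of mass `y` at `b` and an atom of mass `1 - y` at `vbar`. -/
noncomputable def twoPointCdf (vbar b y v : ℝ) : ℝ :=
  if v < b then 0 else if v < vbar then y else 1

section twoPointCdf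

variable {m vbar b y : ℝ}

lemma twoPointCdf_of_lt {v : ℝ} (h : v < b) : twoPointCdf vbar b y v = 0 := if_pos h

lemma twoPointCdf_of_mem {v : ℝ} (h : b ≤ v) (h' : v < vbar) : twoPointCdf vbar b y v = y := by
  simp [twoPointCdf, h.not_gt, h']

lemma twoPointCdf_of_ge {v : ℝ} (hb : b ≤ vbar) (h : vbar ≤ v) : twoPointCdf vbar b y v = 1 := by
  simp [twoPointCdf, (hb.trans h).not_gt, h.not_gt]

lemma intervalIntegral_comp_twoPointCdf_of_le (φ : ℝ → ℝ) {r : ℝ} (hbr : b ≤ r)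
    (hr : r ≤ vbar) :
    IntervalIntegrable (fun v => φ (twoPointCdf vbar b y v)) volume r vbar ∧
      ∫ v in r..vbar, φ (twoPointCdf vbar b y v) = (vbar - r) * φ y := by
  have h : ∀ v ∈ Ioo r vbar, φ y = φ (twoPointCdf vbar b y v) := fun v hv => by
    rw [twoPointCdf_of_mem (hbr.trans hv.1.le) hv.2]
  constructor
  · refine (intervalIntegrable_const (c := φ y)).congr_uIoo ?_
    rwa [uIoo_of_le hr]
  · rw [intervalIntegral.integral_of_le hr, integral_Ioc_eq_integral_Ioo,
      ← setIntegral_congr_fun measurableSet_Ioo h]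
    simp [hr]

lemma intervalIntegral_comp_twoPointCdf_of_ge (φ : ℝ → ℝ) {r : ℝ} (hrb : r ≤ b)
    (hb : b ≤ vbar) :
    ∫ v in r..vbar, φ (twoPointCdf vbar b y v) = (b - r) * φ 0 + (vbar - b) * φ y := by
  have h : ∀ v ∈ Ioo r b, φ 0 = φ (twoPointCdf vbar b y v) := fun v hv => by
    rw [twoPointCdf_of_lt hv.2]
  have hi : IntervalIntegrable (fun v => φ (twoPointCdf vbar b y v)) volume r b := by
    refine (intervalIntegrable_const (c := φ 0)).congr_uIoo ?_
    rwa [uIoo_of_le hrb]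
  obtain ⟨h1, h2⟩ := intervalIntegral_comp_twoPointCdf_of_le (y := y) φ le_rfl hb
  rw [← intervalIntegral.integral_add_adjacent_intervals hi h1, h2,
    intervalIntegral.integral_of_le hrb, integral_Ioc_eq_integral_Ioo,
    ← setIntegral_congr_fun measurableSet_Ioo h]
  simp [hrb]

lemma monotone_twoPointCdf (hy0 : 0 ≤ y) (hy1 : y ≤ 1) :
    Monotone (twoPointCdf vbar b y) := by
  intro u v huv
  unfold twoPointCdf
  split_ifs <;> linarith

lemma continuousWithinAt_twoPointCdf (hb : b ≤ vbar) (x : ℝ) :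
    ContinuousWithinAt (twoPointCdf vbar b y) (Ici x) x := by
  have key : ∀ {z : ℝ}, x < z →
      (∀ v, x ≤ v → v < z → twoPointCdf vbar b y v = twoPointCdf vbar b y x) →
      ContinuousWithinAt (twoPointCdf vbar b y) (Ici x) x := fun {z} hz h => by
    refine continuousWithinAt_const.congr_of_eventuallyEq
      (f := fun _ => twoPointCdf vbar b y x) ?_ rfl
    filter_upwards [Ico_mem_nhdsGE hz] with v hv using h v hv.1 hv.2
  rcases lt_or_ge x b with h | h
  · exact key h fun v _ hv => by rw [twoPointCdf_of_lt hv, twoPointCdf_of_lt h]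
  rcases lt_or_ge x vbar with h' | h'
  · exact key h' fun v hxv hv => by
      rw [twoPointCdf_of_mem (h.trans hxv) hv, twoPointCdf_of_mem h h']
  · exact key (lt_add_one x) fun v hxv _ => by
      rw [twoPointCdf_of_ge hb (h'.trans hxv), twoPointCdf_of_ge hb h']

lemma delta1_twoPointCdf (hb0 : 0 ≤ b) (hb : b ≤ vbar) (hy0 : 0 ≤ y) (hy1 : y ≤ 1)
    (hm : vbar - m = y * (vbar - b)) : Delta1 m vbar (twoPointCdf vbar b y) := by
  refine ⟨monotone_twoPointCdf hy0 hy1, continuousWithinAt_twoPointCdf hb,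
    fun v hv => twoPointCdf_of_lt (hv.trans_le hb0), fun v hv => twoPointCdf_of_ge hb hv, ?_⟩
  rw [intervalIntegral_comp_twoPointCdf_of_ge (fun t => 1 - t) hb0 hb]
  linarith

lemma revenue_twoPointCdf_of_lt (N : ℕ) (c : ℝ) {r : ℝ} (hrb : r < b) (hb : b ≤ vbar) :
    revenue (N + 2) c (twoPointCdf vbar b y) r = b + (vbar - b) * secondOrderTail N y := by
  rw [revenue_eq_intervalIntegral N c (fun v hv => twoPointCdf_of_ge hb hv) (hrb.le.trans hb),
    intervalIntegral_comp_twoPointCdf_of_ge (secondOrderTail N) hrb.le hb,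
    twoPointCdf_of_lt hrb, secondOrderTail_zero]
  ring

lemma revenue_twoPointCdf_self (N : ℕ) (c : ℝ) (hb : b < vbar) :
    revenue (N + 2) c (twoPointCdf vbar b y) b =
      b - (b - c) * y ^ (N + 2) + (vbar - b) * secondOrderTail N y := by
  rw [revenue_eq_intervalIntegral N c (fun v hv => twoPointCdf_of_ge hb.le hv) hb.le,
    (intervalIntegral_comp_twoPointCdf_of_le (secondOrderTail N) le_rfl hb.le).2,
    twoPointCdf_of_mem le_rfl hb]

end twoPointCdf

lemma exists_revenue_eq {N : ℕ} {c m vbar : ℝ} (hN : 1 ≤ N) (hc : 0 ≤ c) (hmv : m < vbar)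
    (hcond : vbar - m ≤ tangencyPoint N * (vbar - c)) :
    ∃ a, c ≤ a ∧ a < vbar ∧ vbar - m = tangencyPoint N * (vbar - a) ∧
      ∃ F, Delta1 m vbar F ∧
        (∀ r < a, revenue (N + 2) c F r = vbar - tangentSlope N * (vbar - m)) ∧
        revenue (N + 2) c F a =
          vbar - tangentSlope N * (vbar - m) - (a - c) * tangencyPoint N ^ (N + 2) := by
  have hx : 0 < tangencyPoint N := by
    have : (0 : ℝ) < N := by exact_mod_cast hN
    unfold tangencyPoint; positivity
  have hm : vbar - m = tangencyPoint N * (vbar - (vbar - (vbar - m) / tangencyPoint N)) := by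
    field_simp; ring
  have ha : c ≤ vbar - (vbar - m) / tangencyPoint N := by
    rw [le_sub_comm, div_le_iff₀ hx]; linarith
  have hv : vbar - (vbar - m) / tangencyPoint N < vbar :=
    sub_lt_self _ (div_pos (sub_pos.2 hmv) hx)
  refine ⟨_, ha, hv, hm, _, delta1_twoPointCdf (hc.trans ha) hv.le hx.le
    (tangencyPoint_le_one N) hm, fun r hr => ?_, ?_⟩
  · rw [revenue_twoPointCdf_of_lt N c hr hv.le, secondOrderTail_tangencyPoint]
    linear_combination tangentSlope N * hm
  · rw [revenue_twoPointCdf_self N c hv, secondOrderTail_tangencyPoint]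
    linear_combination tangentSlope N * hm

lemma exists_revenue_le {N : ℕ} {c m vbar r : ℝ} (hN : 1 ≤ N) (hc : 0 ≤ c) (hcm : c < m)
    (hmv : m < vbar) (hcond : vbar - m ≤ tangencyPoint N * (vbar - c)) (hr : c < r) :
    ∃ F, Delta1 m vbar F ∧
      revenue (N + 2) c F r ≤ vbar - tangentSlope N * (vbar - m) := by
  obtain ⟨a, hca, hav, hm, F, hF, hlt, heq⟩ := exists_revenue_eq hN hc hmv hcond
  have hx := tangencyPoint_nonneg N
  rcases lt_or_ge r a with hra | har
  · exact ⟨F, hF, (hlt r hra).le⟩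
  rcases le_or_gt m r with hmr | hrm
  · have hD : Delta1 m vbar (twoPointCdf vbar m 1) :=
      delta1_twoPointCdf (hc.trans hcm.le) hmv.le zero_le_one le_rfl (by ring)
    have h1 : ∀ v, m ≤ v → twoPointCdf vbar m 1 v = 1 := fun v hv => by
      simp [twoPointCdf, hv.not_gt]
    refine ⟨_, hD, ?_⟩
    have h2 : ∫ v in Ioi r, secondOrderTail N (twoPointCdf vbar m 1 v) = 0 :=
      setIntegral_eq_zero_of_forall_eq_zero fun v hv => by
        rw [h1 v (hmr.trans (le_of_lt hv)), secondOrderTail_one]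
    rw [revenue_eq, h1 r hmr, h2]
    have h3 := hF.le_revenue_of_le N hca
    have h4 : 0 ≤ (a - c) * tangencyPoint N ^ (N + 2) :=
      mul_nonneg (sub_nonneg.2 hca) (pow_nonneg hx _)
    simp only [one_pow]
    linarith
  · have hrv : 0 < vbar - r := by linarith
    obtain ⟨y, hy⟩ : ∃ y, vbar - m = y * (vbar - r) := ⟨(vbar - m) / (vbar - r), by field_simp⟩
    have hxy : tangencyPoint N ≤ y := by
      refine le_of_mul_le_mul_right ?_ hrv
      rw [← hy, hm]
      gcongr
    have hy1 : y ≤ 1 := by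
      refine le_of_mul_le_mul_right ?_ hrv
      linarith
    refine ⟨_, delta1_twoPointCdf (hc.trans hr.le) (by linarith) (hx.trans hxy) hy1 hy, ?_⟩
    rw [revenue_twoPointCdf_self N c (by linarith)]
    have hx' : 0 < tangencyPoint N := by
      have : (0 : ℝ) < N := by exact_mod_cast hN
      unfold tangencyPoint; positivity
    have key := tangentSlope_mul_tangencyPoint_le hN hxy hy1
    have h1 : tangencyPoint N * (secondOrderTail N y - 1 + tangentSlope N * y) ≤
        (y - tangencyPoint N) * y ^ (N + 2) := by
      have := mul_le_mul_of_nonneg_right key (hx.trans hxy)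
      unfold secondOrderTail
      ring_nf at this ⊢
      linarith
    have h2 : (y - tangencyPoint N) * (vbar - r) ≤ tangencyPoint N * (r - c) := by linarith
    have h3 := mul_le_mul_of_nonneg_right h1 hrv.le
    have h4 := mul_le_mul_of_nonneg_right h2 (pow_nonneg (hx.trans hxy) (N + 2))
    have h5 : (secondOrderTail N y - 1 + tangentSlope N * y) * (vbar - r) ≤
        (r - c) * y ^ (N + 2) := by
      refine le_of_mul_le_mul_left ?_ hx'
      linarith
    rw [hy]
    linarith

theorem all_prices_below_c_maxmin_delta1
    (n : ℕ) (hn : 2 ≤ n) (c m vbar : ℝ)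
    (hc : 0 ≤ c) (hcm : c < m) (hmv : m < vbar)
    (hcond : (vbar - c) / (m - c) ≤ ((n : ℝ) - 1) ^ 2) :
    ∀ r ∈ Set.Icc (0:ℝ) c,
      sInf {x | ∃ F, Delta1 m vbar F ∧ x = revenue n c F r} =
        sInf {x | ∃ F, Delta1 m vbar F ∧ x = revenue n c F c} ∧
      sInf {x | ∃ F, Delta1 m vbar F ∧ x = revenue n c F c} =
        sSup {y | ∃ r' : ℝ, 0 ≤ r' ∧
          y = sInf {x | ∃ F, Delta1 m vbar F ∧ x = revenue n c F r'}} := by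
  obtain ⟨N, rfl⟩ := Nat.exists_eq_add_of_le' hn
  have hcond' : vbar - m ≤ tangencyPoint N * (vbar - c) := by
    have h : ((N + 2 : ℕ) : ℝ) - 1 = N + 1 := by push_cast; ring
    rw [h, div_le_iff₀ (by linarith)] at hcond
    have h2 : (vbar - c) / ((N : ℝ) + 1) ^ 2 ≤ m - c := by
      rw [div_le_iff₀ (by positivity)]
      linarith
    have h3 : tangencyPoint N * (vbar - c) = vbar - c - (vbar - c) / ((N : ℝ) + 1) ^ 2 := by
      rw [tangencyPoint_eq]; ring
    linarith
  have hN : 1 ≤ N := by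
    rcases Nat.eq_zero_or_pos N with rfl | h
    · simp [tangencyPoint] at hcond'
      linarith
    · exact h
  have hmin : ∀ r ∈ Set.Icc (0:ℝ) c,
      sInf {x | ∃ F, Delta1 m vbar F ∧ x = revenue (N + 2) c F r} =
        vbar - tangentSlope N * (vbar - m) := by
    rintro r ⟨hr0, hrc⟩
    refine IsLeast.csInf_eq ⟨?_, ?_⟩
    · obtain ⟨a, hca, -, -, F, hF, hlt, heq⟩ := exists_revenue_eq hN hc hmv hcond'
      refine ⟨F, hF, ?_⟩
      rcases (hrc.trans hca).eq_or_lt with rfl | hra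
      · rw [heq, le_antisymm hrc hca]
        ring
      · exact (hlt r hra).symm
    · rintro _ ⟨F, hF, rfl⟩
      exact hF.sub_tangentSlope_mul_le_revenue N hr0 hrc (hcm.trans hmv).le
  intro r hr
  refine ⟨by rw [hmin r hr, hmin c ⟨hc, le_rfl⟩], ?_⟩
  symm
  refine IsGreatest.csSup_eq ⟨⟨c, hc, rfl⟩, ?_⟩
  rintro _ ⟨r', hr', rfl⟩
  rw [hmin c ⟨hc, le_rfl⟩]
  rcases le_or_gt r' c with h | h
  · exact (hmin r' ⟨hr', h⟩).le
  · obtain ⟨F, hF, hle⟩ := exists_revenue_le hN hc hcm hmv hcond' h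
    refine le_trans (csInf_le ⟨c, ?_⟩ ?_) hle
    · rintro _ ⟨G, hG, rfl⟩
      exact hG.le_revenue_of_le N h.le
    · exact ⟨F, hF, rfl⟩
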